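/- Let Q be a symmetric n×n real matrix, q ∈ ℝⁿ, f(x) = ½xᵀQx + qᵀx, and C = {x ∈ ℝⁿ : Ax ≥ b}. If y ∈ C is a KKT point of min{f(x) : x ∈ C} (i.e., ⟨Qy + q, u − y⟩ ≥ 0 for all u ∈ C), then for every x ∈ C one has f(y) − f(x) ≤ ‖Q‖ ‖y − x‖², where ‖Q‖ is the operator norm of Q. -/

import Mathlib

open RealInnerProductSpace Filter Topology

/-- Second-order expansion of a quadratic function with symmetric linear part. -/
theorem LinearMap.IsSymmetric.quadratic_sub {E : Type*} [NormedAddCommGroup E]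
    [InnerProductSpace ℝ E] {T : E →ₗ[ℝ] E} (hT : T.IsSymmetric) (q x y : E) :
    ((1/2) * ⟪T y, y⟫ + ⟪q, y⟫) - ((1/2) * ⟪T x, x⟫ + ⟪q, x⟫) =
      -⟪T y + q, x - y⟫ - (1/2) * ⟪T (y - x), y - x⟫ := by
  have h : ⟪T x, y⟫ = ⟪T y, x⟫ := by rw [hT x y, real_inner_comm]
  simp only [map_sub, inner_add_left, inner_sub_left, inner_sub_right, h]
  ring

/-- if `y` is a KKT point, then `f(y) - f(x) ≤ ‖Q‖ ‖y - x‖²` for all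
feasible `x`, where `‖Q‖` is the operator norm of `Q`. -/
theorem stmt_14 {n m : ℕ} (Q : Matrix (Fin n) (Fin n) ℝ) (hQ : Q.IsHermitian)
    (q : EuclideanSpace ℝ (Fin n)) (A : Matrix (Fin m) (Fin n) ℝ) (b : Fin m → ℝ)
    (C : Set (EuclideanSpace ℝ (Fin n)))
    (hC : C = {x : EuclideanSpace ℝ (Fin n) | ∀ i, b i ≤ Matrix.toEuclideanLin A x i})
    (f : EuclideanSpace ℝ (Fin n) → ℝ)
    (hf : ∀ x, f x = (1/2) * ⟪Matrix.toEuclideanLin Q x, x⟫ + ⟪q, x⟫)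
    (y : EuclideanSpace ℝ (Fin n)) (hyC : y ∈ C)
    (hKKT : ∀ u ∈ C, 0 ≤ ⟪Matrix.toEuclideanLin Q y + q, u - y⟫) :
    ∀ x ∈ C, f y - f x ≤ ‖Matrix.toEuclideanCLM (𝕜 := ℝ) Q‖ * ‖y - x‖^2 := by
  intro x hx
  have hT := Matrix.isSymmetric_toEuclideanLin_iff.mpr hQ
  have hnorm := (Matrix.toEuclideanCLM (𝕜 := ℝ) Q).le_opNorm (y - x)
  have hinner : -⟪Matrix.toEuclideanLin Q (y - x), y - x⟫ ≤
      ‖Matrix.toEuclideanCLM (𝕜 := ℝ) Q‖ * ‖y - x‖ ^ 2 :=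
    calc -⟪Matrix.toEuclideanLin Q (y - x), y - x⟫
        ≤ ‖Matrix.toEuclideanCLM (𝕜 := ℝ) Q (y - x)‖ * ‖y - x‖ :=
          (neg_le_abs _).trans (abs_real_inner_le_norm _ _)
      _ ≤ ‖Matrix.toEuclideanCLM (𝕜 := ℝ) Q‖ * ‖y - x‖ * ‖y - x‖ := by gcongr
      _ = ‖Matrix.toEuclideanCLM (𝕜 := ℝ) Q‖ * ‖y - x‖ ^ 2 := by ring
  have hnonneg : 0 ≤ ‖Matrix.toEuclideanCLM (𝕜 := ℝ) Q‖ * ‖y - x‖ ^ 2 := by positivity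
  rw [hf, hf, hT.quadratic_sub]
  linarith [hKKT x hx]
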